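/- arXiv:2210.17333 — 10 statements merged into one kernel-verified Lean document; each statement's English description precedes it below -/
import Mathlib

section
/- Let (A,B) and (C,D) be disjoint pairs of RE subsets of ℕ. If (A,B) is doubly generative (DG) and (A,B) is reducible to (C,D), then (C,D) is doubly generative. -/
/-- The `e`-th recursively enumerable set in the standard enumeration:
the domain of the `e`-th partial recursive function. -/
def WSet (e : ℕ) : Set ℕ :=
  {x | (Nat.Partrec.Code.eval (Denumerable.ofNat Nat.Partrec.Code e) x).Dom}

/-- A set of naturals is recursively enumerable iff it occurs in the standard enumeration. -/
def IsRE (A : Set ℕ) : Prop := ∃ e, A = WSet e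

/-- `(A,B)` is semi-reducible to `(C,D)`. -/
def SemiReducible (A B C D : Set ℕ) : Prop :=
  ∃ f : ℕ → ℕ, Computable f ∧ (∀ x, x ∈ A → f x ∈ C) ∧ (∀ x, x ∈ B → f x ∈ D)

/-- `(A,B)` is reducible to `(C,D)`. -/
def Reducible (A B C D : Set ℕ) : Prop :=
  ∃ f : ℕ → ℕ, Computable f ∧ (∀ x, x ∈ A ↔ f x ∈ C) ∧ (∀ x, x ∈ B ↔ f x ∈ D)

/-- `(C,D)` is semi-doubly universal: every disjoint pair of RE sets is semi-reducible to it. -/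
def SemiDU (C D : Set ℕ) : Prop :=
  ∀ A B : Set ℕ, IsRE A → IsRE B → A ∩ B = ∅ → SemiReducible A B C D

/-- `(C,D)` is doubly universal: every disjoint pair of RE sets is reducible to it. -/
def DU (C D : Set ℕ) : Prop :=
  ∀ A B : Set ℕ, IsRE A → IsRE B → A ∩ B = ∅ → Reducible A B C D

/-- A binary relation on ℕ is RE (via a recursive pairing). -/
def IsRERel2 (M : ℕ → ℕ → Prop) : Prop :=
  ∃ e, ∀ x y, M x y ↔ Nat.pair x y ∈ WSet e

/-- `(A,B)` has a separation function. -/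
def HasSepFun (A B : Set ℕ) : Prop :=
  ∃ S : ℕ → ℕ → ℕ → ℕ, Computable (fun p : ℕ × ℕ × ℕ => S p.1 p.2.1 p.2.2) ∧
    ∀ M₁ M₂ : ℕ → ℕ → Prop, IsRERel2 M₁ → IsRERel2 M₂ →
      ∃ h : ℕ, ∀ x y : ℕ,
        (M₁ x y ∧ ¬ M₂ x y → S h x y ∈ A) ∧
        (M₂ x y ∧ ¬ M₁ x y → S h x y ∈ B)

/-- `(A,B)` is effectively inseparable. -/
def EI (A B : Set ℕ) : Prop :=
  ∃ f : ℕ → ℕ → ℕ, Computable₂ f ∧ ∀ i j, A ⊆ WSet i → B ⊆ WSet j →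
    WSet i ∩ WSet j = ∅ → f i j ∉ WSet i ∪ WSet j

/-- `(A,B)` is completely effectively inseparable. -/
def CEI (A B : Set ℕ) : Prop :=
  ∃ f : ℕ → ℕ → ℕ, Computable₂ f ∧ ∀ i j, A ⊆ WSet i → B ⊆ WSet j →
    (f i j ∈ WSet i ↔ f i j ∈ WSet j)

/-- `(A,B)` is doubly generative. -/
def DG (A B : Set ℕ) : Prop :=
  ∃ f : ℕ → ℕ → ℕ, Computable₂ f ∧ ∀ i j, WSet i ∩ WSet j = ∅ →
    ((f i j ∈ A ↔ f i j ∈ WSet i) ∧ (f i j ∈ B ↔ f i j ∈ WSet j))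

/-- `(A,B)` is semi-doubly generative. -/
def SemiDG (A B : Set ℕ) : Prop :=
  ∃ f : ℕ → ℕ → ℕ, Computable₂ f ∧ ∀ i j, WSet i ∩ WSet j = ∅ →
    ((f i j ∈ WSet i → f i j ∈ A) ∧ (f i j ∈ WSet j → f i j ∈ B))

/-- `(A,B)` is doubly co-productive. -/
def DCP (A B : Set ℕ) : Prop :=
  ∃ f : ℕ → ℕ → ℕ, Computable₂ f ∧ ∀ i j, WSet i ∩ WSet j = ∅ →
    WSet i ∩ A = ∅ → WSet j ∩ B = ∅ → f i j ∉ A ∪ B ∪ WSet i ∪ WSet j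

/-- `(A,B)` is weakly effectively inseparable. -/
def WEI (A B : Set ℕ) : Prop :=
  ∃ f : ℕ → ℕ → ℕ, Computable₂ f ∧ ∀ i j,
    (WSet i = A → WSet j = B → f i j ∉ A ∪ B) ∧
    (WSet i = A → WSet j = B ∪ {f i j} → f i j ∈ A) ∧
    (WSet i = A ∪ {f i j} → WSet j = B → f i j ∈ B)

/-- `(A,B)` is weakly doubly co-productive. -/
def WDCP (A B : Set ℕ) : Prop :=
  ∃ f : ℕ → ℕ → ℕ, Computable₂ f ∧ ∀ i j,
    (WSet i = ∅ → WSet j = ∅ → f i j ∉ A ∪ B) ∧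
    (WSet i = ∅ → WSet j = {f i j} → f i j ∈ B) ∧
    (WSet i = {f i j} → WSet j = ∅ → f i j ∈ A)

open Nat.Partrec in
lemma exists_preimage_index (g : ℕ → ℕ) (hg : Computable g) :
    ∃ s : ℕ → ℕ, Computable s ∧ ∀ e x, x ∈ WSet (s e) ↔ g x ∈ WSet e := by
  obtain ⟨c, hc⟩ := Code.exists_code.1 (Partrec.nat_iff.1 hg.partrec)
  refine ⟨fun e => Encodable.encode (Code.comp (Denumerable.ofNat Code e) c), ?_, ?_⟩
  · exact (Primrec.encode.comp
      (Code.primrec₂_comp.comp (Primrec.ofNat Code) (Primrec.const c))).to_comp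
  · intro e x
    simp only [WSet, Code.eval, hc, Denumerable.ofNat_encode, Set.mem_setOf_eq, PFun.coe_val]
    exact iff_of_eq (congrArg Part.Dom (Part.bind_some (g x) _))

theorem DG_of_reducible (A B C D : Set ℕ) (hA : IsRE A) (hB : IsRE B) (hC : IsRE C) (hD : IsRE D)
    (hAB : A ∩ B = ∅) (hCD : C ∩ D = ∅)
    (h1 : DG A B) (h2 : Reducible A B C D) : DG C D := by
  obtain ⟨f, hf, hfp⟩ := h1
  obtain ⟨g, hg, hgA, hgB⟩ := h2
  obtain ⟨s, hs, hsp⟩ := exists_preimage_index g hg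
  refine ⟨fun i j => g (f (s i) (s j)),
    hg.comp (hf.comp (hs.comp Computable.fst) (hs.comp Computable.snd)), ?_⟩
  intro i j hij
  have hd : WSet (s i) ∩ WSet (s j) = ∅ := by
    ext x
    simp only [Set.mem_inter_iff, hsp, Set.mem_empty_iff_false, iff_false]
    intro hx
    have hm : g x ∈ WSet i ∩ WSet j := hx
    rw [hij] at hm
    exact hm
  obtain ⟨ha, hb⟩ := hfp _ _ hd
  exact ⟨(hgA _).symm.trans (ha.trans (hsp _ _)), (hgB _).symm.trans (hb.trans (hsp _ _))⟩
end

section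
/- Let (A,B) and (C,D) be disjoint pairs of RE subsets of ℕ. If (A,B) is semi-DG and (A,B) is reducible to (C,D), then (C,D) is semi-DG. -/
theorem semiDG_of_reducible (A B C D : Set ℕ) (hA : IsRE A) (hB : IsRE B) (hC : IsRE C) (hD : IsRE D)
    (hAB : A ∩ B = ∅) (hCD : C ∩ D = ∅)
    (h1 : SemiDG A B) (h2 : Reducible A B C D) : SemiDG C D := by
  obtain ⟨f, hf, hfp⟩ := h1
  obtain ⟨g, hg, hgA, hgB⟩ := h2
  obtain ⟨c, hc⟩ := Nat.Partrec.Code.exists_code.1 (Partrec.nat_iff.1 hg.partrec)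
  let t : ℕ → ℕ := fun i =>
    Encodable.encode (Nat.Partrec.Code.comp (Denumerable.ofNat Nat.Partrec.Code i) c)
  have ht : Computable t :=
    (Primrec.encode.comp (Nat.Partrec.Code.primrec₂_comp.comp
      (Primrec.ofNat Nat.Partrec.Code) (Primrec.const c))).to_comp
  have hmem : ∀ i x, x ∈ WSet (t i) ↔ g x ∈ WSet i := by
    intro i x
    simp only [WSet, t, Nat.Partrec.Code.eval, hc, Set.mem_ofPred_eq, Denumerable.ofNat_encode,
      PFun.coe_val]
    change ((Part.some (g x)).bind (Denumerable.ofNat Nat.Partrec.Code i).eval).Dom ↔ _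
    exact iff_of_eq (congrArg Part.Dom (Part.bind_some (g x) _))
  refine ⟨fun i j => g (f (t i) (t j)),
    hg.comp (hf.comp (ht.comp Computable.fst) (ht.comp Computable.snd)), ?_⟩
  intro i j hij
  have hd : WSet (t i) ∩ WSet (t j) = ∅ := by
    ext x
    have : ¬ (g x ∈ WSet i ∩ WSet j) := by simp [hij]
    simpa [hmem] using this
  obtain ⟨ha, hb⟩ := hfp _ _ hd
  exact ⟨fun h => (hgA _).1 (ha ((hmem _ _).2 h)), fun h => (hgB _).1 (hb ((hmem _ _).2 h))⟩
end

section
/- Let (A,B) and (C,D) be disjoint pairs of RE subsets of ℕ. If (A,B) is weakly effectively inseparable (WEI) and (A,B) is reducible to (C,D), then (C,D) is weakly effectively inseparable. -/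
/-- The point at which the diagonalisation takes place. -/
def weiPoint (f : ℕ → ℕ → ℕ) (a b : ℕ) (c : Nat.Partrec.Code) (i j : ℕ) : ℕ :=
  f (Encodable.encode (c.curry (Nat.pair (Nat.pair i j) (Nat.pair i a))))
    (Encodable.encode (c.curry (Nat.pair (Nat.pair i j) (Nat.pair j b))))

theorem weiPoint_computable {α : Type} [Primcodable α] {f : ℕ → ℕ → ℕ} (hf : Computable₂ f)
    (a b : ℕ) {c : α → Nat.Partrec.Code} {i j : α → ℕ}
    (hc : Computable c) (hi : Computable i) (hj : Computable j) :
    Computable (fun p : α => weiPoint f a b (c p) (i p) (j p)) := by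
  have hij := Primrec₂.natPair.to_comp.comp hi hj
  have h1 := Computable.encode.comp (Nat.Partrec.Code.primrec₂_curry.to_comp.comp hc
    (Primrec₂.natPair.to_comp.comp hij
      (Primrec₂.natPair.to_comp.comp hi (Computable.const a))))
  have h2 := Computable.encode.comp (Nat.Partrec.Code.primrec₂_curry.to_comp.comp hc
    (Primrec₂.natPair.to_comp.comp hij
      (Primrec₂.natPair.to_comp.comp hj (Computable.const b))))
  exact hf.comp h1 h2

theorem weiCode_aux {X Y E D : Nat.Partrec.Code × ℕ → ℕ} {g : ℕ → ℕ} (hg : Computable g)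
    (hX : Computable X) (hy : Computable Y) (he : Computable E) (hd : Computable D) :
    ∃ c : Nat.Partrec.Code, ∀ m, c.eval m = Nat.Partrec.Code.eval
      (Denumerable.ofNat Nat.Partrec.Code
        (bif decide (Y (c, m) = X (c, m)) then E (c, m) else D (c, m)))
      (bif decide (Y (c, m) = X (c, m)) then g (Y (c, m)) else Y (c, m)) := by
  have hq : Computable (fun p : Nat.Partrec.Code × ℕ => decide (Y p = X p)) :=
    (Primrec.eq (α := ℕ)).decide.to_comp.comp hy hX
  have hF : Partrec₂ (fun (c : Nat.Partrec.Code) (m : ℕ) =>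
      Nat.Partrec.Code.eval (Denumerable.ofNat Nat.Partrec.Code
        (bif decide (Y (c, m) = X (c, m)) then E (c, m) else D (c, m)))
        (bif decide (Y (c, m) = X (c, m)) then g (Y (c, m)) else Y (c, m))) :=
    Partrec₂.comp (f := Nat.Partrec.Code.eval) Nat.Partrec.Code.eval_part
      ((Computable.ofNat _).comp (Computable.cond hq he hd))
      (Computable.cond hq (hg.comp hy) hy)
  obtain ⟨c, hc⟩ := Nat.Partrec.Code.fixed_point₂ hF
  exact ⟨c, fun m => congrFun hc m⟩

theorem exists_weiCode {f : ℕ → ℕ → ℕ} (hf : Computable₂ f) {g : ℕ → ℕ} (hg : Computable g)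
    (a b : ℕ) : ∃ c : Nat.Partrec.Code, ∀ i j e d y,
      c.eval (Nat.pair (Nat.pair (Nat.pair i j) (Nat.pair e d)) y) =
        if y = weiPoint f a b c i j then
          Nat.Partrec.Code.eval (Denumerable.ofNat Nat.Partrec.Code e) (g y)
        else Nat.Partrec.Code.eval (Denumerable.ofNat Nat.Partrec.Code d) y := by
  obtain ⟨X, X_def⟩ : ∃ X : Nat.Partrec.Code × ℕ → ℕ, X = fun p =>
    weiPoint f a b p.1 p.2.unpair.1.unpair.1.unpair.1 p.2.unpair.1.unpair.1.unpair.2 := ⟨_, rfl⟩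
  have l : Primrec (fun n : ℕ => n.unpair.1) := Primrec.fst.comp Primrec.unpair
  have r : Primrec (fun n : ℕ => n.unpair.2) := Primrec.snd.comp Primrec.unpair
  have sn : Primrec (fun p : Nat.Partrec.Code × ℕ => p.2) := Primrec.snd
  have hi : Computable (fun p : Nat.Partrec.Code × ℕ => p.2.unpair.1.unpair.1.unpair.1) :=
    (l.comp (l.comp (l.comp sn))).to_comp
  have hj : Computable (fun p : Nat.Partrec.Code × ℕ => p.2.unpair.1.unpair.1.unpair.2) :=
    (r.comp (l.comp (l.comp sn))).to_comp
  have hX : Computable X := by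
    rw [X_def]
    exact weiPoint_computable hf a b Computable.fst hi hj
  have hy : Computable (fun p : Nat.Partrec.Code × ℕ => p.2.unpair.2) := (r.comp sn).to_comp
  have he : Computable (fun p : Nat.Partrec.Code × ℕ => p.2.unpair.1.unpair.2.unpair.1) :=
    (l.comp (r.comp (l.comp sn))).to_comp
  have hd : Computable (fun p : Nat.Partrec.Code × ℕ => p.2.unpair.1.unpair.2.unpair.2) :=
    (r.comp (r.comp (l.comp sn))).to_comp
  obtain ⟨c, hc⟩ := weiCode_aux hg hX hy he hd
  refine ⟨c, fun i j e d y => ?_⟩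
  rw [hc]
  by_cases h : y = weiPoint f a b c i j <;> simp [X_def, h]

theorem WEI_of_reducible (A B C D : Set ℕ) (hA : IsRE A) (hB : IsRE B) (hC : IsRE C) (hD : IsRE D)
    (hAB : A ∩ B = ∅) (hCD : C ∩ D = ∅)
    (h1 : WEI A B) (h2 : Reducible A B C D) : WEI C D := by
  obtain ⟨f, hf, hW⟩ := h1
  obtain ⟨g, hg, hgA, hgB⟩ := h2
  obtain ⟨a, rfl⟩ := hA
  obtain ⟨b, rfl⟩ := hB
  obtain ⟨c, hc⟩ := exists_weiCode hf hg a b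
  refine ⟨fun i j => g (weiPoint f a b c i j), ?_, fun i j => ?_⟩
  · exact hg.comp (weiPoint_computable hf a b (Computable.const c) Computable.fst Computable.snd)
  have key : ∀ e d y, y ∈ WSet (Encodable.encode
      (c.curry (Nat.pair (Nat.pair i j) (Nat.pair e d)))) ↔
      if y = weiPoint f a b c i j then g y ∈ WSet e else y ∈ WSet d := by
    intro e d y
    simp only [WSet, Set.mem_ofPred_eq, Denumerable.ofNat_encode, Nat.Partrec.Code.eval_curry, hc]
    split_ifs <;> rfl
  have h := hW (Encodable.encode (c.curry (Nat.pair (Nat.pair i j) (Nat.pair i a))))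
    (Encodable.encode (c.curry (Nat.pair (Nat.pair i j) (Nat.pair j b))))
  change (_ → _ → weiPoint f a b c i j ∉ _) ∧ (_ → _ = _ ∪ {weiPoint f a b c i j} → weiPoint f a b c i j ∈ _) ∧
    (_ = _ ∪ {weiPoint f a b c i j} → _ → weiPoint f a b c i j ∈ _) at h
  have same : ∀ (e d : ℕ) (S : Set ℕ), (∀ x, x ∈ WSet d ↔ g x ∈ S) → WSet e = S →
      WSet (Encodable.encode (c.curry (Nat.pair (Nat.pair i j) (Nat.pair e d)))) = WSet d := by
    rintro e d S hS rfl
    ext y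
    rw [key, hS y]
    simp
  have extend : ∀ (e d : ℕ) (S : Set ℕ), WSet e = S ∪ {g (weiPoint f a b c i j)} →
      WSet (Encodable.encode (c.curry (Nat.pair (Nat.pair i j) (Nat.pair e d)))) =
        WSet d ∪ {weiPoint f a b c i j} := by
    intro e d S he
    ext y
    rw [key, he]
    by_cases hy : y = weiPoint f a b c i j <;> simp [hy]
  obtain ⟨p1, p2, p3⟩ := h
  refine ⟨fun hi hj => ?_, fun hi hj => ?_, fun hi hj => ?_⟩
  · have := p1 (same _ _ _ hgA hi) (same _ _ _ hgB hj)
    simpa only [Set.mem_union, ← hgA, ← hgB] using this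
  · exact (hgA _).1 (p2 (same _ _ _ hgA hi) (extend _ _ _ hj))
  · exact (hgB _).1 (p3 (extend _ _ _ hi) (same _ _ _ hgB hj))
end

section
/- Let (A,B) and (C,D) be disjoint pairs of RE subsets of ℕ. If (A,B) is weakly doubly co-productive (WDCP) and (A,B) is reducible to (C,D), then (C,D) is weakly doubly co-productive. -/
open Nat.Partrec in
/-- The diagonal value attached to a code `c` and the parameter `q = ⟨i, j⟩`. -/
def diagVal (f : ℕ → ℕ → ℕ) (c : Code) (q : ℕ) : ℕ :=
  f (Encodable.encode (Code.curry c (Nat.pair q.unpair.1 q)))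
    (Encodable.encode (Code.curry c (Nat.pair q.unpair.2 q)))

open Nat.Partrec in
theorem diagVal_computable {f : ℕ → ℕ → ℕ} (hf : Computable₂ f) : Computable₂ (diagVal f) := by
  have hu : Computable (fun p : Code × ℕ => p.2.unpair) :=
    Computable.unpair.comp Computable.snd
  have hpair : Computable₂ Nat.pair := Primrec₂.natPair.to_comp
  have hc : Computable₂ Code.curry := Code.primrec₂_curry.to_comp
  have h1 : Computable (fun p : Code × ℕ =>
      Encodable.encode (Code.curry p.1 (Nat.pair p.2.unpair.1 p.2))) :=
    Computable.encode.comp (hc.comp Computable.fst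
      (hpair.comp (Computable.fst.comp hu) Computable.snd))
  have h2 : Computable (fun p : Code × ℕ =>
      Encodable.encode (Code.curry p.1 (Nat.pair p.2.unpair.2 p.2))) :=
    Computable.encode.comp (hc.comp Computable.fst
      (hpair.comp (Computable.snd.comp hu) Computable.snd))
  exact hf.comp h1 h2

open Nat.Partrec in
theorem exists_diag {f : ℕ → ℕ → ℕ} {g : ℕ → ℕ} (hf : Computable₂ f) (hg : Computable g) :
    ∃ c : Code, ∀ s q x, x ∈ WSet (Encodable.encode (Code.curry c (Nat.pair s q))) ↔
      x = diagVal f c q ∧ g (diagVal f c q) ∈ WSet s := by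
  let F : Code → ℕ →. ℕ := fun c n =>
    bif decide (n.unpair.2 = diagVal f c n.unpair.1.unpair.2) then
      Code.eval (Denumerable.ofNat Code n.unpair.1.unpair.1)
        (g (diagVal f c n.unpair.1.unpair.2))
    else Part.none
  have hF : Partrec₂ F := by
    have hn : Computable (fun p : Code × ℕ => p.2.unpair) :=
      Computable.unpair.comp Computable.snd
    have hn1 : Computable (fun p : Code × ℕ => p.2.unpair.1.unpair) :=
      Computable.unpair.comp (Computable.fst.comp hn)
    have hv : Computable (fun p : Code × ℕ => diagVal f p.1 p.2.unpair.1.unpair.2) :=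
      (diagVal_computable hf).comp Computable.fst (Computable.snd.comp hn1)
    have hd : Computable₂ (fun a b : ℕ => decide (a = b)) := by
      exact (Primrec.eq (α := ℕ)).decide.to_comp
    have he : Partrec (fun p : Code × ℕ =>
        Code.eval (Denumerable.ofNat Code p.2.unpair.1.unpair.1)
          (g (diagVal f p.1 p.2.unpair.1.unpair.2))) :=
      Code.eval_part.comp ((Computable.ofNat Code).comp (Computable.fst.comp hn1)) (hg.comp hv)
    exact Partrec.cond (hd.comp (Computable.snd.comp hn) hv) he Partrec.none
  obtain ⟨c, hc⟩ := Code.fixed_point₂ hF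
  refine ⟨c, fun s q x => ?_⟩
  by_cases hx : x = diagVal f c q <;>
    simp [WSet, Code.eval_curry, hc, F, hx]

theorem WDCP_of_reducible (A B C D : Set ℕ) (hA : IsRE A) (hB : IsRE B) (hC : IsRE C) (hD : IsRE D)
    (hAB : A ∩ B = ∅) (hCD : C ∩ D = ∅)
    (h1 : WDCP A B) (h2 : Reducible A B C D) : WDCP C D := by
  obtain ⟨f, hf, H⟩ := h1
  obtain ⟨g, hg, gA, gB⟩ := h2
  obtain ⟨c, hc⟩ := exists_diag hf hg
  refine ⟨fun i j => g (diagVal f c (Nat.pair i j)),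
    hg.comp ((diagVal_computable hf).comp (Computable.const c)
      (Primrec₂.natPair.to_comp : Computable₂ Nat.pair)), fun i j => ?_⟩
  have hi := hc i (Nat.pair i j)
  have hj := hc j (Nat.pair i j)
  have hv : f (Encodable.encode (Nat.Partrec.Code.curry c (Nat.pair i (Nat.pair i j))))
      (Encodable.encode (Nat.Partrec.Code.curry c (Nat.pair j (Nat.pair i j))))
      = diagVal f c (Nat.pair i j) := by simp [diagVal]
  have K := H (Encodable.encode (Nat.Partrec.Code.curry c (Nat.pair i (Nat.pair i j))))
    (Encodable.encode (Nat.Partrec.Code.curry c (Nat.pair j (Nat.pair i j))))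
  rw [hv] at K
  obtain ⟨K1, K2, K3⟩ := K
  refine ⟨fun h h' => ?_, fun h h' => ?_, fun h h' => ?_⟩
  · have := K1 (by ext x; simp [hi, h]) (by ext x; simp [hj, h'])
    simpa [gA, gB] using this
  · exact (gB _).1 (K2 (by ext x; simp [hi, h]) (by ext x; simp [hj, h']))
  · exact (gA _).1 (K3 (by ext x; simp [hi, h]) (by ext x; simp [hj, h']))
end

section
/- If a disjoint pair (A,B) of RE subsets of ℕ is weakly effectively inseparable (WEI), then (A,B) is doubly generative (DG). -/
open Nat.Partrec in
theorem wset_re : REPred fun p : ℕ × ℕ => p.2 ∈ WSet p.1 := by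
  have h : Partrec fun p : ℕ × ℕ => Code.eval (Denumerable.ofNat Code p.1) p.2 :=
    Code.eval_part.comp ((Computable.ofNat Code).comp Computable.fst) Computable.snd
  exact h.dom_re

theorem REPred.comp_aux {α β : Type*} [Primcodable α] [Primcodable β] {p : β → Prop}
    (hp : REPred p) {f : α → β} (hf : Computable f) : REPred fun a => p (f a) :=
  Partrec.comp hp hf

theorem REPred.and_aux {α : Type*} [Primcodable α] {p q : α → Prop}
    (hp : REPred p) (hq : REPred q) : REPred fun a => p a ∧ q a := by
  have h := Partrec.bind hp (Partrec.comp hq (Computable.fst (α := α) (β := Unit))).to₂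
  refine h.dom_re.of_eq fun a => ?_
  simp [Part.assert, Part.bind]

theorem REPred.or_aux {α : Type*} [Primcodable α] {p q : α → Prop}
    (hp : REPred p) (hq : REPred q) : REPred fun a => p a ∨ q a := by
  obtain ⟨k, hk, H⟩ := Partrec.merge' hp hq
  refine hk.dom_re.of_eq fun a => ?_
  rw [(H a).2]
  simp [Part.assert]

open Nat.Partrec in
/-- Index of the parametrised set. -/
def idxT (c : Code) (u k i j : ℕ) : ℕ :=
  Encodable.encode (Code.curry c (Nat.pair (Nat.pair u k) (Nat.pair i j)))

open Nat.Partrec in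
/-- The value of the WEI function at the two self-referential indices. -/
def idxZ (g : ℕ → ℕ → ℕ) (a b : ℕ) (c : Code) (i j : ℕ) : ℕ :=
  g (idxT c a j i j) (idxT c b i i j)

open Nat.Partrec in
theorem idxT_computable {α : Type*} [Primcodable α] {c : α → Code} {u k i j : α → ℕ}
    (hc : Computable c) (hu : Computable u) (hk : Computable k) (hi : Computable i)
    (hj : Computable j) : Computable fun p => idxT (c p) (u p) (k p) (i p) (j p) := by
  have pairC : Computable₂ Nat.pair := Primrec₂.natPair.to_comp
  have curC : Computable₂ Code.curry := Code.primrec₂_curry.to_comp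
  have h1 : Computable fun p => Nat.pair (u p) (k p) := pairC.comp hu hk
  have h2 : Computable fun p => Nat.pair (i p) (j p) := pairC.comp hi hj
  have h3 : Computable fun p => Nat.pair (Nat.pair (u p) (k p)) (Nat.pair (i p) (j p)) :=
    pairC.comp h1 h2
  exact Computable.encode.comp (curC.comp hc h3)

open Nat.Partrec in
theorem idxZ_computable {g : ℕ → ℕ → ℕ} (hg : Computable₂ g) (a b : ℕ)
    {α : Type*} [Primcodable α] {c : α → Code} {i j : α → ℕ}
    (hc : Computable c) (hi : Computable i) (hj : Computable j) :
    Computable fun p => idxZ g a b (c p) (i p) (j p) := by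
  have h1 := idxT_computable hc (Computable.const a) hj hi hj
  have h2 := idxT_computable hc (Computable.const b) hi hi hj
  exact hg.comp h1 h2

set_option maxHeartbeats 1000000 in
open Nat.Partrec in
theorem DG_of_WEI (A B : Set ℕ) (hA : IsRE A) (hB : IsRE B) (hAB : A ∩ B = ∅)
    (h : WEI A B) : DG A B := by
  obtain ⟨a, rfl⟩ := hA
  obtain ⟨b, rfl⟩ := hB
  obtain ⟨g, hg, H⟩ := h
  let T := idxT
  let Z : Code → ℕ → ℕ → ℕ := idxZ g a b
  have unC : Computable Nat.unpair := Primrec.unpair.to_comp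
  let P : Code × ℕ → Prop := fun q =>
    q.2.unpair.2 ∈ WSet q.2.unpair.1.unpair.1.unpair.1 ∨
      (q.2.unpair.2 = Z q.1 q.2.unpair.1.unpair.2.unpair.1 q.2.unpair.1.unpair.2.unpair.2 ∧
        q.2.unpair.2 ∈ WSet q.2.unpair.1.unpair.1.unpair.2)
  have hP : REPred P := by
    have u : Computable fun q : Code × ℕ => q.2.unpair := unC.comp Computable.snd
    have x : Computable fun q : Code × ℕ => q.2.unpair.2 := Computable.snd.comp u
    have v : Computable fun q : Code × ℕ => q.2.unpair.1.unpair :=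
      unC.comp (Computable.fst.comp u)
    have v1 : Computable fun q : Code × ℕ => q.2.unpair.1.unpair.1.unpair :=
      unC.comp (Computable.fst.comp v)
    have v2 : Computable fun q : Code × ℕ => q.2.unpair.1.unpair.2.unpair :=
      unC.comp (Computable.snd.comp v)
    have z : Computable fun q : Code × ℕ =>
        Z q.1 q.2.unpair.1.unpair.2.unpair.1 q.2.unpair.1.unpair.2.unpair.2 :=
      idxZ_computable hg a b Computable.fst (Computable.fst.comp v2) (Computable.snd.comp v2)
    have e : REPred fun p : ℕ × ℕ => p.1 = p.2 :=
      ComputablePred.to_re (Primrec.eq (α := ℕ)).computablePred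
    have r1 := wset_re.comp_aux ((Computable.fst.comp v1).pair x)
    have r2 := e.comp_aux (x.pair z)
    have r3 := wset_re.comp_aux ((Computable.snd.comp v1).pair x)
    exact r1.or_aux (r2.and_aux r3)
  obtain ⟨c, hc⟩ := Code.fixed_point₂
    (f := fun c n => (Part.assert (P (c, n)) fun _ => Part.some ()).map fun _ => 0)
    (Partrec.map hP (Computable.const 0).to₂)
  have key : ∀ u k i j x, x ∈ WSet (T c u k i j) ↔ x ∈ WSet u ∨ (x = Z c i j ∧ x ∈ WSet k) := by
    intro u k i j x
    change (Code.eval (Denumerable.ofNat Code (T c u k i j)) x).Dom ↔ _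
    simp only [T, idxT, Denumerable.ofNat_encode, Code.eval_curry, hc]
    simp [P, Part.assert]
  refine ⟨Z c, idxZ_computable hg a b (Computable.const c) Computable.fst Computable.snd, fun i j hij => ?_⟩
  obtain ⟨h1, h2, h3⟩ := H (T c a j i j) (T c b i i j)
  change _ → _ → Z c i j ∉ _ at h1
  change _ → _ = _ ∪ {Z c i j} → Z c i j ∈ _ at h2
  change _ = _ ∪ {Z c i j} → _ → Z c i j ∈ _ at h3
  have d1 : ∀ x, ¬ (x ∈ WSet i ∧ x ∈ WSet j) := fun x hx => (hij ▸ hx : x ∈ (∅ : Set ℕ))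
  have d2 : ∀ x, ¬ (x ∈ WSet a ∧ x ∈ WSet b) := fun x hx => (hAB ▸ hx : x ∈ (∅ : Set ℕ))
  have dz1 := d1 (Z c i j)
  have dz2 := d2 (Z c i j)
  have eq0 : ∀ u k, Z c i j ∉ WSet k → WSet (T c u k i j) = WSet u := by
    intro u k hk
    ext x
    rw [key]
    constructor
    · rintro (hx | ⟨rfl, hx⟩)
      · exact hx
      · exact absurd hx hk
    · exact Or.inl
  have eq1 : ∀ u k, Z c i j ∈ WSet k → WSet (T c u k i j) = WSet u ∪ {Z c i j} := by
    intro u k hk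
    ext x
    rw [key]
    constructor
    · rintro (hx | ⟨rfl, hx⟩)
      · exact Or.inl hx
      · exact Or.inr rfl
    · rintro (hx | rfl)
      · exact Or.inl hx
      · exact Or.inr ⟨rfl, hk⟩
  by_cases hi : Z c i j ∈ WSet i
  · have hj : Z c i j ∉ WSet j := fun hj => dz1 ⟨hi, hj⟩
    have ha := h2 (eq0 _ _ hj) (eq1 _ _ hi)
    exact ⟨⟨fun _ => hi, fun _ => ha⟩, ⟨fun hb => (dz2 ⟨ha, hb⟩).elim, fun hj' => (hj hj').elim⟩⟩
  · by_cases hj : Z c i j ∈ WSet j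
    · have hb := h3 (eq1 _ _ hj) (eq0 _ _ hi)
      exact ⟨⟨fun ha => (dz2 ⟨ha, hb⟩).elim, fun hi' => (hi hi').elim⟩,
        ⟨fun _ => hj, fun _ => hb⟩⟩
    · have hn := h1 (eq0 _ _ hj) (eq0 _ _ hi)
      exact ⟨⟨fun ha => (hn (Or.inl ha)).elim, fun hi' => (hi hi').elim⟩,
        ⟨fun hb => (hn (Or.inr hb)).elim, fun hj' => (hj hj').elim⟩⟩
end

section
/- If a disjoint pair (C,D) of RE subsets of ℕ is weakly doubly co-productive (WDCP), then (C,D) is doubly universal (DU). -/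
open Nat.Partrec Nat.Partrec.Code in
theorem DU_of_WDCP (C D : Set ℕ) (hC : IsRE C) (hD : IsRE D) (hCD : C ∩ D = ∅)
    (h : WDCP C D) : DU C D := by
  obtain ⟨f, hf, hprop⟩ := h
  rintro A B ⟨a, rfl⟩ ⟨b, rfl⟩ hAB
  let idx : Code → ℕ → ℕ → ℕ := fun c k y => Encodable.encode (curry (curry c k) y)
  have hidx : ∀ k, Computable₂ (fun (c : Code) (y : ℕ) => idx c k y) := fun k =>
    (Primrec.encode.comp (primrec₂_curry.comp
      (primrec₂_curry.comp Primrec.fst (Primrec.const k)) Primrec.snd)).to_comp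
  let H : Code → ℕ → ℕ := fun c y => f (idx c 0 y) (idx c 1 y)
  have hH : Computable₂ H := hf.comp (hidx 0) (hidx 1)
  let F : Code → ℕ →. ℕ := fun c n =>
    cond (decide (n.unpair.2.unpair.2 = H c n.unpair.2.unpair.1))
      (eval (cond (decide (n.unpair.1 = 0)) (Denumerable.ofNat Code a) (Denumerable.ofNat Code b))
        n.unpair.2.unpair.1) Part.none
  have u1 : Primrec (fun p : Code × ℕ => p.2.unpair.1) :=
    Primrec.fst.comp (Primrec.unpair.comp Primrec.snd)
  have u2 : Primrec (fun p : Code × ℕ => p.2.unpair.2) :=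
    Primrec.snd.comp (Primrec.unpair.comp Primrec.snd)
  have u3 : Primrec (fun p : Code × ℕ => p.2.unpair.2.unpair.1) :=
    Primrec.fst.comp (Primrec.unpair.comp u2)
  have u4 : Primrec (fun p : Code × ℕ => p.2.unpair.2.unpair.2) :=
    Primrec.snd.comp (Primrec.unpair.comp u2)
  have deq : Computable₂ (fun x y : ℕ => decide (x = y)) :=
    (Primrec.eq (α := ℕ)).decide.to_comp
  have hF : Partrec₂ F := by
    refine Partrec.cond ?_ (eval_part.comp (Computable.cond ?_ (Computable.const _)
      (Computable.const _)) u3.to_comp) Partrec.none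
    · exact deq.comp u4.to_comp (hH.comp Computable.fst u3.to_comp)
    · exact deq.comp u1.to_comp (Computable.const 0)
  obtain ⟨c, hc⟩ := fixed_point₂ hF
  have hW : ∀ k y x, x ∈ WSet (idx c k y) ↔ x = H c y ∧ y ∈ WSet (cond (decide (k = 0)) a b) := by
    intro k y x
    simp only [WSet, Set.mem_ofPred_eq, idx, Denumerable.ofNat_encode, eval_curry, hc, F,
      Nat.unpair_pair]
    by_cases hx : x = H c y <;> by_cases hk : k = 0 <;> simp [hx, hk]
  have h0 : ∀ y x, x ∈ WSet (idx c 0 y) ↔ x = H c y ∧ y ∈ WSet a := fun y x => by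
    simpa using hW 0 y x
  have h1 : ∀ y x, x ∈ WSet (idx c 1 y) ↔ x = H c y ∧ y ∈ WSet b := fun y x => by
    simpa using hW 1 y x
  have hdis : ∀ y, y ∈ WSet a → y ∉ WSet b := fun y p q => by
    have : y ∈ WSet a ∩ WSet b := ⟨p, q⟩
    simp [hAB] at this
  have hdis' : ∀ y, y ∈ C → y ∉ D := fun y p q => by
    have : y ∈ C ∩ D := ⟨p, q⟩
    simp [hCD] at this
  have key : ∀ y, (y ∈ WSet a → H c y ∈ C) ∧ (y ∈ WSet b → H c y ∈ D) ∧
      (y ∉ WSet a → y ∉ WSet b → H c y ∉ C ∪ D) := by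
    intro y
    obtain ⟨p1, p2, p3⟩ := hprop (idx c 0 y) (idx c 1 y)
    refine ⟨fun ha => p3 ?_ ?_, fun hb => p2 ?_ ?_, fun ha hb => p1 ?_ ?_⟩
    · ext x; rw [h0]; simp [ha, H]
    · ext x; rw [h1]; simp [hdis y ha]
    · ext x; rw [h0]; simpa using fun _ ha => hdis y ha hb
    · ext x; rw [h1]; simp [hb, H]
    · ext x; rw [h0]; simp [ha]
    · ext x; rw [h1]; simp [hb]
  refine ⟨H c, hH.comp (Computable.const c) Computable.id, fun y => ?_, fun y => ?_⟩
  · obtain ⟨k1, k2, k3⟩ := key y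
    have := hdis' (H c y)
    simp only [Set.mem_union] at k3
    tauto
  · obtain ⟨k1, k2, k3⟩ := key y
    have := hdis' (H c y)
    simp only [Set.mem_union] at k3
    tauto
end

section
/- If a disjoint pair (C,D) of RE subsets of ℕ is doubly generative (DG), then (C,D) is weakly effectively inseparable (WEI). -/
theorem WEI_of_DG (C D : Set ℕ) (hC : IsRE C) (hD : IsRE D) (hCD : C ∩ D = ∅)
    (h : DG C D) : WEI C D := by
  obtain ⟨k, hk, hkk⟩ := h
  have hdis : ∀ x, x ∈ C → x ∈ D → False := fun x hx hy => by
    have : x ∈ C ∩ D := ⟨hx, hy⟩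
    rw [hCD] at this
    exact this
  refine ⟨fun i j => k j i, hk.comp Computable.snd Computable.fst, fun i j => ⟨?_, ?_, ?_⟩⟩
  · intro hi hj
    obtain ⟨h1, h2⟩ := hkk j i (by rw [hi, hj, Set.inter_comm]; exact hCD)
    rw [hj] at h1
    rintro (h | h)
    · exact hdis _ h (h1.1 h)
    · exact hdis _ (h1.2 h) h
  · intro hi hj
    by_contra hn
    refine hn ((hkk j i ?_).1.2 (by rw [hj]; exact Or.inr rfl))
    rw [hi, hj]
    ext x
    refine ⟨?_, fun h => h.elim⟩
    rintro ⟨h | h, h'⟩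
    · exact hdis _ h' h
    · rw [Set.mem_singleton_iff] at h
      subst h
      exact hn h'
  · intro hi hj
    by_contra hn
    refine hn ((hkk j i ?_).2.2 (by rw [hi]; exact Or.inr rfl))
    rw [hi, hj]
    ext x
    refine ⟨?_, fun h => h.elim⟩
    rintro ⟨h', h | h⟩
    · exact hdis _ h h'
    · rw [Set.mem_singleton_iff] at h
      subst h
      exact hn h'
end

section
/- For any disjoint pair (A,B) of RE subsets of ℕ, any RE sets C and D, and any recursive function g(x,y), there are recursive functions f₁(y) and f₂(y) such that for all y: (I) if y ∈ A then W_{f₁(y)} = C and W_{f₂(y)} = D ∪ {g(f₁(y), f₂(y))}; (II) if y ∈ B then W_{f₁(y)} = C ∪ {g(f₁(y), f₂(y))} and W_{f₂(y)} = D; (III) if y ∉ A ∪ B then W_{f₁(y)} = C and W_{f₂(y)} = D. -/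
open Nat.Partrec in
theorem aux_selfref (a b c₀ d : Code) (g : ℕ → ℕ → ℕ) (hg : Computable₂ g) :
    ∃ c : Code, ∀ i y x : ℕ,
      (c.eval (Nat.pair (Nat.pair i y) x)).Dom ↔
        ((bif (i == 0) then c₀ else d).eval x).Dom ∨
        (x = g (Encodable.encode (c.curry (Nat.pair 0 y)))
            (Encodable.encode (c.curry (Nat.pair 1 y))) ∧
          ((bif (i == 0) then b else a).eval y).Dom) := by
  have hu : Computable (fun p : Code × ℕ => p.2.unpair) :=
    Computable.unpair.comp Computable.snd
  have hu1 : Computable (fun p : Code × ℕ => p.2.unpair.1.unpair) :=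
    Computable.unpair.comp (Computable.fst.comp hu)
  have hi : Computable (fun p : Code × ℕ => p.2.unpair.1.unpair.1) := Computable.fst.comp hu1
  have hy : Computable (fun p : Code × ℕ => p.2.unpair.1.unpair.2) := Computable.snd.comp hu1
  have hx : Computable (fun p : Code × ℕ => p.2.unpair.2) := Computable.snd.comp hu
  have hi0 : Computable (fun p : Code × ℕ => p.2.unpair.1.unpair.1 == 0) :=
    (Primrec.beq.to_comp).comp hi (Computable.const 0)
  have he : ∀ k : ℕ, Computable (fun p : Code × ℕ =>
      Encodable.encode (p.1.curry (Nat.pair k p.2.unpair.1.unpair.2))) := fun k =>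
    Computable.encode.comp ((Code.primrec₂_curry.to_comp).comp Computable.fst
      ((Primrec₂.natPair.to_comp).comp (Computable.const k) hy))
  have hG := hg.comp (he 0) (he 1)
  have hq : Computable (fun p : Code × ℕ => p.2.unpair.2 ==
      g (Encodable.encode (p.1.curry (Nat.pair 0 p.2.unpair.1.unpair.2)))
        (Encodable.encode (p.1.curry (Nat.pair 1 p.2.unpair.1.unpair.2)))) :=
    (Primrec.beq.to_comp).comp hx hG
  have h1 : Partrec (fun p : Code × ℕ =>
      (bif (p.2.unpair.1.unpair.1 == 0) then c₀ else d).eval p.2.unpair.2) :=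
    Code.eval_part.comp (Computable.cond hi0 (Computable.const c₀) (Computable.const d)) hx
  have h2 : Partrec (fun p : Code × ℕ =>
      (bif (p.2.unpair.1.unpair.1 == 0) then b else a).eval p.2.unpair.1.unpair.2) :=
    Code.eval_part.comp (Computable.cond hi0 (Computable.const b) (Computable.const a)) hy
  have h3 := Partrec.cond hq h2 Partrec.none
  obtain ⟨k, hk, H⟩ := Partrec.merge' h1 h3
  obtain ⟨c, hc⟩ := Code.fixed_point₂ (f := fun c z => k (c, z)) hk
  refine ⟨c, fun i y x => ?_⟩
  have h4 := (H (c, Nat.pair (Nat.pair i y) x)).2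
  have h5 := congrFun hc (Nat.pair (Nat.pair i y) x)
  rw [h5, h4]
  simp only [Nat.unpair_pair]
  refine or_congr_right ?_
  by_cases hx : x = g (Encodable.encode (c.curry (Nat.pair 0 y)))
            (Encodable.encode (c.curry (Nat.pair 1 y)))
  · rw [← hx]; simp
  · rw [beq_eq_false_iff_ne.2 hx]; simp [hx]

theorem double_recursion_with_g (A B C D : Set ℕ)
    (hA : IsRE A) (hB : IsRE B) (hAB : A ∩ B = ∅) (hC : IsRE C) (hD : IsRE D)
    (g : ℕ → ℕ → ℕ) (hg : Computable₂ g) :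
    ∃ f₁ f₂ : ℕ → ℕ, Computable f₁ ∧ Computable f₂ ∧ ∀ y : ℕ,
      (y ∈ A → WSet (f₁ y) = C ∧ WSet (f₂ y) = D ∪ {g (f₁ y) (f₂ y)}) ∧
      (y ∈ B → WSet (f₁ y) = C ∪ {g (f₁ y) (f₂ y)} ∧ WSet (f₂ y) = D) ∧
      (y ∉ A ∪ B → WSet (f₁ y) = C ∧ WSet (f₂ y) = D) := by
  obtain ⟨ea, rfl⟩ := hA
  obtain ⟨eb, rfl⟩ := hB
  obtain ⟨ec, rfl⟩ := hC
  obtain ⟨ed, rfl⟩ := hD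
  obtain ⟨c, hc⟩ := aux_selfref (Denumerable.ofNat _ ea) (Denumerable.ofNat _ eb)
    (Denumerable.ofNat _ ec) (Denumerable.ofNat _ ed) g hg
  have hcomp : ∀ k : ℕ, Computable (fun y : ℕ =>
      Encodable.encode (c.curry (Nat.pair k y))) := fun k =>
    Computable.encode.comp ((Nat.Partrec.Code.primrec₂_curry.to_comp).comp (Computable.const c)
      ((Primrec₂.natPair.to_comp).comp (Computable.const k) Computable.id))
  refine ⟨_, _, hcomp 0, hcomp 1, fun y => ?_⟩
  have m0 : ∀ x, x ∈ WSet (Encodable.encode (c.curry (Nat.pair 0 y))) ↔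
      x ∈ WSet ec ∨ (x = g (Encodable.encode (c.curry (Nat.pair 0 y)))
            (Encodable.encode (c.curry (Nat.pair 1 y))) ∧ y ∈ WSet eb) := fun x => by
    have := hc 0 y x
    simpa [WSet, Nat.Partrec.Code.eval_curry] using this
  have m1 : ∀ x, x ∈ WSet (Encodable.encode (c.curry (Nat.pair 1 y))) ↔
      x ∈ WSet ed ∨ (x = g (Encodable.encode (c.curry (Nat.pair 0 y)))
            (Encodable.encode (c.curry (Nat.pair 1 y))) ∧ y ∈ WSet ea) := fun x => by
    have := hc 1 y x
    simpa [WSet, Nat.Partrec.Code.eval_curry] using this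
  have hdis : ¬ (y ∈ WSet ea ∧ y ∈ WSet eb) := fun h => by
    have : y ∈ WSet ea ∩ WSet eb := h
    rw [hAB] at this
    exact this
  refine ⟨fun h => ⟨?_, ?_⟩, fun h => ⟨?_, ?_⟩, fun h => ⟨?_, ?_⟩⟩ <;> ext x <;>
    simp only [m0, m1, Set.mem_union, Set.mem_singleton_iff] at h ⊢ <;> tauto
end

section
/- If a disjoint pair (A,B) of RE subsets of ℕ is effectively inseparable (EI), then (A,B) is doubly generative (DG). -/
lemma mem_WSet_encode (c : Nat.Partrec.Code) (x : ℕ) :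
    x ∈ WSet (Encodable.encode c) ↔ (c.eval x).Dom := by
  simp [WSet]

lemma partrec_WSet : Partrec₂ (fun e x : ℕ =>
    Nat.Partrec.Code.eval (Denumerable.ofNat Nat.Partrec.Code e) x) :=
  Nat.Partrec.Code.eval_part.comp₂
    ((Computable.ofNat Nat.Partrec.Code).comp Computable.fst).to₂ Computable.snd.to₂

/-- The index obtained from `c` by fixing its parameters. -/
def idx (c : Nat.Partrec.Code) (i j e k : ℕ) : ℕ :=
  Encodable.encode (c.curry (Nat.pair (Nat.pair i j) (Nat.pair e k)))

lemma computable_idx {α : Type*} [Primcodable α] {c : α → Nat.Partrec.Code} {i j e k : α → ℕ}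
    (hc : Computable c) (hi : Computable i) (hj : Computable j) (he : Computable e)
    (hk : Computable k) : Computable (fun a => idx (c a) (i a) (j a) (e a) (k a)) := by
  have hp : Computable₂ Nat.pair := Primrec₂.natPair.to_comp
  exact Computable.encode.comp (Nat.Partrec.Code.primrec₂_curry.to_comp.comp hc
    (hp.comp (hp.comp hi hj) (hp.comp he hk)))

lemma exists_double_fixed (f : ℕ → ℕ → ℕ) (hf : Computable₂ f) (p q : ℕ) :
    ∃ c : Nat.Partrec.Code, ∀ i j e k x, x ∈ WSet (idx c i j e k) ↔
      (x ∈ WSet e ∨ (x = f (idx c i j p j) (idx c i j q i) ∧ x ∈ WSet k)) := by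
  let I : Nat.Partrec.Code × ℕ → ℕ := fun a => a.2.unpair.1.unpair.1.unpair.1
  let J : Nat.Partrec.Code × ℕ → ℕ := fun a => a.2.unpair.1.unpair.1.unpair.2
  let E : Nat.Partrec.Code × ℕ → ℕ := fun a => a.2.unpair.1.unpair.2.unpair.1
  let K : Nat.Partrec.Code × ℕ → ℕ := fun a => a.2.unpair.1.unpair.2.unpair.2
  let X : Nat.Partrec.Code × ℕ → ℕ := fun a => a.2.unpair.2
  have u1 : Computable (fun n : ℕ => n.unpair.1) := (Primrec.fst.comp Primrec.unpair).to_comp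
  have u2 : Computable (fun n : ℕ => n.unpair.2) := (Primrec.snd.comp Primrec.unpair).to_comp
  have h2 : Computable (fun a : Nat.Partrec.Code × ℕ => a.2) := Computable.snd
  have hI : Computable I := u1.comp (u1.comp (u1.comp h2))
  have hJ : Computable J := u2.comp (u1.comp (u1.comp h2))
  have hE : Computable E := u1.comp (u2.comp (u1.comp h2))
  have hK : Computable K := u2.comp (u2.comp (u1.comp h2))
  have hX : Computable X := u2.comp h2
  have hc : Computable (fun a : Nat.Partrec.Code × ℕ => a.1) := Computable.fst
  let Z : Nat.Partrec.Code × ℕ → ℕ := fun a =>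
    f (idx a.1 (I a) (J a) p (J a)) (idx a.1 (I a) (J a) q (I a))
  have hZ : Computable Z := hf.comp (computable_idx hc hI hJ (Computable.const p) hJ)
    (computable_idx hc hI hJ (Computable.const q) hI)
  have hFE : Partrec (fun a => Nat.Partrec.Code.eval (Denumerable.ofNat Nat.Partrec.Code (E a)) (X a)) :=
    partrec_WSet.comp hE hX
  have hFK : Partrec (fun a => Nat.Partrec.Code.eval (Denumerable.ofNat Nat.Partrec.Code (K a)) (X a)) :=
    partrec_WSet.comp hK hX
  obtain ⟨M, hM, hMs⟩ := Partrec.merge' hFE hFK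
  have hb : Computable (fun a => decide (X a = Z a)) :=
    (Primrec.eq (α := ℕ)).decide.to_comp.comp hX hZ
  have hF := Partrec.cond hb hM hFE
  obtain ⟨c, hc⟩ := Nat.Partrec.Code.fixed_point₂ (f := fun c n => _) hF.to₂
  refine ⟨c, fun i j e k x => ?_⟩
  have hMd := (hMs (c, Nat.pair (Nat.pair (Nat.pair i j) (Nat.pair e k)) x)).2
  unfold idx
  rw [mem_WSet_encode, Nat.Partrec.Code.eval_curry, hc]
  simp only [I, J, E, K, X, Z, Nat.unpair_pair] at hMd ⊢
  by_cases hx : x = f (idx c i j p j) (idx c i j q i)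
  · have hx' := hx
    unfold idx at hx'
    simp only [decide_eq_true hx, cond_true, hMd]
    simp only [← hx', true_and]
    rfl
  · have hx' := hx
    unfold idx at hx'
    simp only [decide_eq_false hx, cond_false, hx', false_and, or_false]
    rfl

theorem DG_of_EI (A B : Set ℕ) (hA : IsRE A) (hB : IsRE B) (hAB : A ∩ B = ∅)
    (h : EI A B) : DG A B := by
  obtain ⟨p, rfl⟩ := hA
  obtain ⟨q, rfl⟩ := hB
  obtain ⟨f, hf, hfE⟩ := h
  obtain ⟨c, hc⟩ := exists_double_fixed f hf p q
  refine ⟨fun i j => f (idx c i j p j) (idx c i j q i), ?_, fun i j hij => ?_⟩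
  · have hi : Computable (fun a : ℕ × ℕ => a.1) := Computable.fst
    have hj : Computable (fun a : ℕ × ℕ => a.2) := Computable.snd
    exact hf.comp (computable_idx (Computable.const c) hi hj (Computable.const p) hj)
      (computable_idx (Computable.const c) hi hj (Computable.const q) hi)
  · have ha := hc i j p j
    have hb := hc i j q i
    have key := hfE (idx c i j p j) (idx c i j q i)
    simp only
    generalize f (idx c i j p j) (idx c i j q i) = z at *
    generalize idx c i j p j = a at *
    generalize idx c i j q i = b at *
    simp only [Set.eq_empty_iff_forall_notMem, Set.mem_inter_iff, Set.mem_union,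
      Set.subset_def] at *
    have key' := key (fun x hx => (ha x).2 (Or.inl hx)) (fun x hx => (hb x).2 (Or.inl hx))
    have hz := ha z
    have hz' := hb z
    have d := hAB z
    have d' := hij z
    have key2 : (¬ ∃ x, x ∈ WSet a ∧ x ∈ WSet b) → ¬(z ∈ WSet a ∨ z ∈ WSet b) := by
      intro h; exact key' (fun x hx => h ⟨x, hx⟩)
    by_cases hex : ∃ x, x ∈ WSet a ∧ x ∈ WSet b
    · obtain ⟨x, h1, h2⟩ := hex
      have dx := hAB x
      rw [ha] at h1
      rw [hb] at h2
      clear key key' key2 ha hb hz hz' hAB hij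
      by_cases hxz : x = z
      · subst hxz; grind
      · grind
    · have hh := key2 hex
      rw [hz, hz'] at hh
      clear key key' key2 ha hb hz hz' hAB hij hex
      grind
end

section
/- A disjoint pair (A,B) of RE subsets of ℕ is effectively inseparable (EI) if and only if it is doubly generative (DG). -/
open Nat.Partrec (Code) in
open Nat.Partrec.Code in
/-- Parametrized double recursion theorem in the form needed below. -/
theorem EI_aux_recursion (f : ℕ → ℕ → ℕ) (hf : Computable₂ f) (a b : ℕ) :
    ∃ s t : ℕ → ℕ → ℕ, Computable₂ s ∧ Computable₂ t ∧ ∀ i j x,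
      (x ∈ WSet (s i j) ↔ x ∈ WSet a ∨ (x = f (s i j) (t i j) ∧ x ∈ WSet j)) ∧
      (x ∈ WSet (t i j) ↔ x ∈ WSet b ∨ (x = f (s i j) (t i j) ∧ x ∈ WSet i)) := by
  let S : Code → ℕ → ℕ → ℕ := fun c i j =>
    Encodable.encode (curry c (Nat.pair (Nat.pair a j) (Nat.pair i j)))
  let T : Code → ℕ → ℕ → ℕ := fun c i j =>
    Encodable.encode (curry c (Nat.pair (Nat.pair b i) (Nat.pair i j)))
  have hpair : Computable₂ Nat.pair := Primrec₂.natPair.to_comp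
  have hcurry : Computable₂ curry := primrec₂_curry.to_comp
  have hS : Computable (fun p : Code × ℕ × ℕ => S p.1 p.2.1 p.2.2) := by
    have hi : Computable (fun p : Code × ℕ × ℕ => p.2.1) :=
      Computable.fst.comp Computable.snd
    have hj : Computable (fun p : Code × ℕ × ℕ => p.2.2) :=
      Computable.snd.comp Computable.snd
    exact Computable.encode.comp (hcurry.comp Computable.fst
      (hpair.comp (hpair.comp (Computable.const a) hj) (hpair.comp hi hj)))
  have hT : Computable (fun p : Code × ℕ × ℕ => T p.1 p.2.1 p.2.2) := by
    have hi : Computable (fun p : Code × ℕ × ℕ => p.2.1) :=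
      Computable.fst.comp Computable.snd
    have hj : Computable (fun p : Code × ℕ × ℕ => p.2.2) :=
      Computable.snd.comp Computable.snd
    exact Computable.encode.comp (hcurry.comp Computable.fst
      (hpair.comp (hpair.comp (Computable.const b) hi) (hpair.comp hi hj)))
  have hSe : ∀ c i j, S c i j =
    Encodable.encode (curry c (Nat.pair (Nat.pair a j) (Nat.pair i j))) := fun _ _ _ => rfl
  have hTe : ∀ c i j, T c i j =
    Encodable.encode (curry c (Nat.pair (Nat.pair b i) (Nat.pair i j))) := fun _ _ _ => rfl
  clear_value S T
  -- the arguments are `n = ((u, v), (i, j)), x`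
  have hn : Computable (fun p : Code × ℕ => p.2.unpair) :=
    Computable.unpair.comp Computable.snd
  have hx : Computable (fun p : Code × ℕ => p.2.unpair.2) := Computable.snd.comp hn
  have hq : Computable (fun p : Code × ℕ => p.2.unpair.1.unpair) :=
    Computable.unpair.comp (Computable.fst.comp hn)
  have huv : Computable (fun p : Code × ℕ => p.2.unpair.1.unpair.1.unpair) :=
    Computable.unpair.comp (Computable.fst.comp hq)
  have hij : Computable (fun p : Code × ℕ => p.2.unpair.1.unpair.2.unpair) :=
    Computable.unpair.comp (Computable.snd.comp hq)
  have h1 : Computable (fun p : Code × ℕ => p.1) := Computable.fst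
  have hg : Computable (fun p : Code × ℕ => (p.1, p.2.unpair.1.unpair.2.unpair)) :=
    Computable.pair h1 hij
  have hSp : Computable (fun p : Code × ℕ => S p.1 p.2.unpair.1.unpair.2.unpair.1 p.2.unpair.1.unpair.2.unpair.2) :=
    hS.comp hg
  have hTp : Computable (fun p : Code × ℕ => T p.1 p.2.unpair.1.unpair.2.unpair.1 p.2.unpair.1.unpair.2.unpair.2) :=
    hT.comp hg
  have hz : Computable (fun p : Code × ℕ =>
      f (S p.1 p.2.unpair.1.unpair.2.unpair.1 p.2.unpair.1.unpair.2.unpair.2)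
        (T p.1 p.2.unpair.1.unpair.2.unpair.1 p.2.unpair.1.unpair.2.unpair.2)) :=
    hf.comp hSp hTp
  have heq : Computable (fun p : Code × ℕ => decide (p.2.unpair.2 =
      f (S p.1 p.2.unpair.1.unpair.2.unpair.1 p.2.unpair.1.unpair.2.unpair.2)
        (T p.1 p.2.unpair.1.unpair.2.unpair.1 p.2.unpair.1.unpair.2.unpair.2))) :=
    (Primrec.eq (α := ℕ)).decide.to_comp.comp hx hz
  have hu : Partrec (fun p : Code × ℕ =>
      eval (Denumerable.ofNat Code p.2.unpair.1.unpair.1.unpair.1) p.2.unpair.2) :=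
    eval_part.comp ((Computable.ofNat Code).comp (Computable.fst.comp huv)) hx
  have hv : Partrec (fun p : Code × ℕ =>
      eval (Denumerable.ofNat Code p.2.unpair.1.unpair.1.unpair.2) p.2.unpair.2) :=
    eval_part.comp ((Computable.ofNat Code).comp (Computable.snd.comp huv)) hx
  obtain ⟨k, hk, hkd⟩ := Partrec.merge' hu (Partrec.cond heq hv Partrec.none)
  obtain ⟨c, hc⟩ := fixed_point₂ (f := fun c n => k (c, n)) hk
  have key : ∀ u v i j x,
      x ∈ WSet (Encodable.encode (curry c (Nat.pair (Nat.pair u v) (Nat.pair i j)))) ↔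
        x ∈ WSet u ∨ (x = f (S c i j) (T c i j) ∧ x ∈ WSet v) := by
    intro u v i j x
    have h := (hkd (c, Nat.pair (Nat.pair (Nat.pair u v) (Nat.pair i j)) x)).2
    simp only [Nat.unpair_pair] at h
    simp only [WSet, Set.mem_setOf_eq, Denumerable.ofNat_encode, eval_curry, hc]
    rw [h]
    by_cases e : x = f (S c i j) (T c i j)
    · simp [← e]
    · simp [e]
  have hS' : Computable₂ (S c) := hS.comp ((Computable.const c).pair Computable.id)
  have hT' : Computable₂ (T c) := hT.comp ((Computable.const c).pair Computable.id)
  refine ⟨S c, T c, hS', hT', fun i j x => ?_⟩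
  have h1 := key a j i j x
  have h2 := key b i i j x
  rw [← hSe] at h1
  rw [← hTe] at h2
  exact ⟨h1, h2⟩

theorem EI_iff_DG (A B : Set ℕ) (hA : IsRE A) (hB : IsRE B) (hAB : A ∩ B = ∅) :
    EI A B ↔ DG A B := by
  have dis : ∀ {X Y : Set ℕ}, X ∩ Y = ∅ ↔ ∀ x, x ∈ X → x ∈ Y → False := by
    intro X Y
    simp [Set.eq_empty_iff_forall_notMem]
  constructor
  · rintro ⟨f, hf, H⟩
    obtain ⟨a, rfl⟩ := hA
    obtain ⟨b, rfl⟩ := hB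
    obtain ⟨s, t, hs, ht, h⟩ := EI_aux_recursion f hf a b
    refine ⟨fun i j => f (s i j) (t i j), hf.comp hs ht, fun i j hij => ?_⟩
    beta_reduce
    have h1 := H (s i j) (t i j) (fun x hx => (h i j x).1.2 (Or.inl hx))
      (fun x hx => (h i j x).2.2 (Or.inl hx))
    have hs' := fun x => (h i j x).1
    have ht' := fun x => (h i j x).2
    rw [dis] at hAB hij h1
    simp only [Set.mem_union, hs', ht'] at h1
    generalize f (s i j) (t i j) = z at *
    have e := hij z
    have e' := hAB z
    show (z ∈ WSet a ↔ z ∈ WSet i) ∧ (z ∈ WSet b ↔ z ∈ WSet j)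
    grind
  · rintro ⟨g, hg, H⟩
    refine ⟨fun i j => g j i, hg.comp Computable.snd Computable.fst, fun i j hi hj hij => ?_⟩
    have h := H j i (by rwa [Set.inter_comm])
    rw [dis] at hij
    rintro (hz | hz)
    · exact hij _ hz (hj (h.2.2 hz))
    · exact hij _ (hi (h.1.2 hz)) hz
end
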